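/- Let n, r, t be positive integers with t > binomial(n + 2r + 1, r). Then R(A_t, Q_n) ≥ n + 2r + 2. In particular, if t ≥ n + 4, then R(A_t, Q_n) ≥ n + 4. -/

import Mathlib

open Finset

/-- The poset Ramsey number `R(P,Q)`: the least `N` such that every blue/red coloring of the
Boolean lattice `Q_N` (subsets of `Fin N` ordered by inclusion, colors as `Bool` with
`true` = blue, `false` = red) contains a blue induced copy of `P` or a red induced copy of `Q`,
where an induced copy is the image of an order embedding. -/
noncomputable def posetRamsey (P : Type*) (Q : Type*) [PartialOrder P] [PartialOrder Q] : ℕ :=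
  sInf {N : ℕ | ∀ c : Finset (Fin N) → Bool,
    (∃ e : P ↪o Finset (Fin N), ∀ p, c (e p) = true) ∨
    (∃ e : Q ↪o Finset (Fin N), ∀ q, c (e q) = false)}

/-- The antichain `A_t`: `t` pairwise incomparable elements. -/
def AntichainP (t : ℕ) : Type := Fin t

instance (t : ℕ) : PartialOrder (AntichainP t) where
  le a b := a = b
  le_refl _ := rfl
  le_trans _ _ _ h₁ h₂ := Eq.trans h₁ h₂
  le_antisymm _ _ h _ := h

theorem Nat.choose_le_choose_of_le_half {N k r : ℕ} (hkr : k ≤ r) (hr : 2 * r ≤ N) :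
    N.choose k ≤ N.choose r := by
  induction r, hkr using Nat.le_induction with
  | base => exact le_rfl
  | succ m _ ih => exact (ih (by omega)).trans (Nat.choose_le_succ_of_lt_half_left (by omega))

/-- An antichain of sets whose sizes are all at most `r` or at least `N - r`
has at most `N.choose r` members. -/
theorem card_le_choose_of_isAntichain_of_extreme {N r : ℕ} (hr : 2 * r ≤ N)
    (𝒜 : Finset (Finset (Fin N))) (h𝒜 : IsAntichain (· ⊆ ·) (𝒜 : Set (Finset (Fin N))))
    (hs : ∀ s ∈ 𝒜, #s ≤ r ∨ N ≤ #s + r) : #𝒜 ≤ N.choose r := by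
  have hpos : (0 : ℚ) < N.choose r := by exact_mod_cast Nat.choose_pos (by omega)
  have hterm : ∀ s ∈ 𝒜, ((N.choose r : ℚ))⁻¹ ≤ ((N.choose #s : ℚ))⁻¹ := by
    intro s hmem
    have hle : #s ≤ N := by simpa using card_le_univ s
    refine inv_anti₀ (by exact_mod_cast Nat.choose_pos hle) ?_
    norm_cast
    rcases hs s hmem with h | h
    · exact Nat.choose_le_choose_of_le_half h hr
    · rw [← Nat.choose_symm hle]
      exact Nat.choose_le_choose_of_le_half (by omega) hr
  have hsum := (sum_le_sum hterm).trans
    (by simpa using lubell_yamamoto_meshalkin_inequality_sum_inv_choose (𝕜 := ℚ) h𝒜)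
  rw [sum_const, nsmul_eq_mul, ← div_eq_mul_inv, div_le_one hpos] at hsum
  exact_mod_cast hsum

theorem StrictMono.card_bot_add_card_le {α β : Type*} [DecidableEq α]
    {f : Finset α → Finset β} (hf : StrictMono f) (s : Finset α) : #(f ∅) + #s ≤ #(f s) := by
  induction s using Finset.induction_on with
  | empty => simp
  | insert a s ha ih =>
    have := card_lt_card (hf (ssubset_insert ha))
    rw [card_insert_of_notMem ha]
    omega

/-- Every coloring of the Boolean lattice of dimension `N` has a blue copy of `P` or a red copy
of `Q`. -/
def IsPosetRamsey (P : Type*) (Q : Type*) [PartialOrder P] [PartialOrder Q] (N : ℕ) : Prop :=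
  ∀ c : Finset (Fin N) → Bool,
    (∃ e : P ↪o Finset (Fin N), ∀ p, c (e p) = true) ∨
    (∃ e : Q ↪o Finset (Fin N), ∀ q, c (e q) = false)

theorem IsPosetRamsey.mono {P Q : Type*} [PartialOrder P] [PartialOrder Q] {M N : ℕ}
    (hMN : M ≤ N) (h : IsPosetRamsey P Q M) : IsPosetRamsey P Q N := by
  intro c
  let i : Finset (Fin M) ↪o Finset (Fin N) := mapEmbedding (Fin.castLEEmb hMN)
  rcases h (fun s => c (i s)) with ⟨e, he⟩ | ⟨e, he⟩
  · exact Or.inl ⟨e.trans i, he⟩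
  · exact Or.inr ⟨e.trans i, he⟩

theorem isPosetRamsey_antichain (t n : ℕ) :
    IsPosetRamsey (AntichainP t) (Finset (Fin n)) (n + t) := by
  intro c
  let φ : Fin t → Finset (Fin n) → Finset (Fin (n + t)) := fun i s =>
    mapEmbedding finSumFinEquiv.toEmbedding (s.disjSum {i})
  have hφ : ∀ i j s u, φ i s ≤ φ j u ↔ s ≤ u ∧ i = j := by
    intro i j s u
    simp only [φ, OrderEmbedding.le_iff_le]
    constructor
    · intro h
      refine ⟨fun a ha => ?_, ?_⟩
      · simpa using h (inl_mem_disjSum.2 ha)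
      · simpa using h (inr_mem_disjSum.2 (mem_singleton_self i))
    · rintro ⟨h, rfl⟩
      exact disjSum_mono h subset_rfl
  by_cases hred : ∃ i, ∀ s, c (φ i s) = false
  · obtain ⟨i, hi⟩ := hred
    exact Or.inr ⟨OrderEmbedding.ofMapLEIff (φ i) fun s u => by simp [hφ], hi⟩
  · push Not at hred
    choose s hs using hred
    refine Or.inl ⟨OrderEmbedding.ofMapLEIff (fun i : AntichainP t => φ i (s i)) ?_, ?_⟩
    · intro i j
      refine (hφ i j (s i) (s j)).trans ?_
      constructor
      · exact fun h => h.2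
      · intro h
        have hij : i = j := h
        subst hij
        exact ⟨le_rfl, rfl⟩
    · intro i
      simpa using hs i

theorem not_isPosetRamsey_antichain {n r t : ℕ} (h : (n + 2 * r + 1).choose r < t) :
    ¬ IsPosetRamsey (AntichainP t) (Finset (Fin n)) (n + 2 * r + 1) := by
  intro hR
  rcases hR (fun s => decide (#s ≤ r ∨ n + 2 * r + 1 ≤ #s + r)) with ⟨e, he⟩ | ⟨e, he⟩
  · let f : Fin t ↪ Finset (Fin (n + 2 * r + 1)) := e.toEmbedding
    have hf : ∀ i j, f i ⊆ f j → i = j := fun i j hij => e.le_iff_le.1 hij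
    have hcard := card_le_choose_of_isAntichain_of_extreme (r := r) (by omega) (univ.map f)
      (by
        intro a ha b hb hab hle
        simp only [coe_map, coe_univ, Set.image_univ, Set.mem_range] at ha hb
        obtain ⟨i, rfl⟩ := ha
        obtain ⟨j, rfl⟩ := hb
        exact hab (congrArg f (hf i j hle)))
      (by
        intro a ha
        obtain ⟨i, -, rfl⟩ := mem_map.1 ha
        exact of_decide_eq_true (he i))
    rw [card_map, card_univ, Fintype.card_fin] at hcard
    omega
  · have h₀ := of_decide_eq_false (he ∅)
    have h₁ := of_decide_eq_false (he univ)
    have h₂ := e.strictMono.card_bot_add_card_le univ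
    rw [card_univ, Fintype.card_fin] at h₂
    omega

theorem le_posetRamsey_antichain {n r t : ℕ} (h : (n + 2 * r + 1).choose r < t) :
    n + 2 * r + 2 ≤ posetRamsey (AntichainP t) (Finset (Fin n)) := by
  have hmem : IsPosetRamsey (AntichainP t) (Finset (Fin n))
      (posetRamsey (AntichainP t) (Finset (Fin n))) :=
    Nat.sInf_mem (s := {N | IsPosetRamsey (AntichainP t) (Finset (Fin n)) N})
      ⟨n + t, isPosetRamsey_antichain t n⟩
  by_contra hlt
  exact not_isPosetRamsey_antichain h (hmem.mono (by omega))

/-- For positive integers `n, r, t` with `t > C(n + 2r + 1, r)`,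
`R(A_t, Q_n) ≥ n + 2r + 2`. In particular, if `t ≥ n + 4` then `R(A_t, Q_n) ≥ n + 4`. -/
theorem antichain_ramsey_lower (n r t : ℕ) (hn : 0 < n) (hr : 0 < r) (ht : 0 < t)
    (h : (n + 2 * r + 1).choose r < t) :
    n + 2 * r + 2 ≤ posetRamsey (AntichainP t) (Finset (Fin n)) ∧
    (∀ n' t' : ℕ, 0 < n' → n' + 4 ≤ t' →
      n' + 4 ≤ posetRamsey (AntichainP t') (Finset (Fin n'))) := by
  refine ⟨le_posetRamsey_antichain h, fun n' t' _ ht' => ?_⟩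
  exact le_posetRamsey_antichain (n := n') (r := 1) (by rw [Nat.choose_one_right]; omega)
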